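/- For ω = e¹² + e³⁴ + e⁵⁶ and φ = e¹³⁵ + e²⁴⁶, the bilinear form q(v₁,v₂) = (ι_{v₁}φ ∧ ι_{v₂}φ ∧ ω)/(ω³/3!) is non-degenerate of split signature (3 positive and 3 negative eigenvalues). -/

import Mathlib

noncomputable section

/-- The model 6-dimensional real vector space. -/
abbrev V6 := Fin 6 → ℝ

/-- Alternating k-forms on V6. -/
abbrev Form (k : ℕ) := AlternatingMap ℝ V6 ℝ (Fin k)

/-- Wedge product of alternating forms (determinant convention). -/
noncomputable def wedge {a b : ℕ} (φ : Form a) (ψ : Form b) : Form (a + b) :=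
  AlternatingMap.domDomCongr finSumFinEquiv
    ((TensorProduct.lid ℝ ℝ).toLinearMap.compAlternatingMap (AlternatingMap.domCoprod φ ψ))

infixl:70 " ⋏ " => wedge

/-- Interior product (contraction) of a form with a vector. -/
noncomputable def iota (v : V6) {k : ℕ} (φ : Form (k + 1)) : Form k :=
  AlternatingMap.curryLeft φ v

/-- The standard dual basis 1-forms e¹, …, e⁶ (0-indexed). -/
noncomputable def e (i : Fin 6) : Form 1 :=
  AlternatingMap.ofSubsingleton ℝ V6 ℝ 0 (LinearMap.proj i)

/-- The standard basis vectors e₁, …, e₆ (0-indexed). -/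
def b (i : Fin 6) : V6 := Pi.single i 1

/-- The standard volume form e¹∧e²∧e³∧e⁴∧e⁵∧e⁶. -/
noncomputable def vol : Form 6 := e 0 ⋏ e 1 ⋏ e 2 ⋏ e 3 ⋏ e 4 ⋏ e 5

/-- The standard symplectic form ω = e¹² + e³⁴ + e⁵⁶. -/
noncomputable def ω : Form 2 := e 0 ⋏ e 1 + e 2 ⋏ e 3 + e 4 ⋏ e 5

/-- The symplectic volume form ω³/3!. -/
noncomputable def volω : Form 6 := (6 : ℝ)⁻¹ • (ω ⋏ ω ⋏ ω : Form 6)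

/-- The decomposable form `e^{I 0} ∧ ⋯ ∧ e^{I (k-1)}` of a multi-index `I`. -/
def basisForm {k : ℕ} (I : Fin k → Fin 6) : Form k :=
  MultilinearMap.alternatization
    ((MultilinearMap.mkPiAlgebra ℝ (Fin k) ℝ).compLinearMap fun i => LinearMap.proj (I i))

theorem basisForm_apply {k : ℕ} (I : Fin k → Fin 6) (v : Fin k → V6) :
    basisForm I v = (Matrix.of fun i j => v i (I j)).det := by
  simp [basisForm, MultilinearMap.alternatization_apply, Matrix.det_apply]

theorem basisForm_wedge {k l : ℕ} (I : Fin k → Fin 6) (J : Fin l → Fin 6) :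
    basisForm I ⋏ basisForm J = basisForm (Fin.append I J) := by
  ext v
  rw [wedge, basisForm, basisForm, ← MultilinearMap.domCoprod_alternization]
  simp only [AlternatingMap.domDomCongr_apply, LinearMap.compAlternatingMap_apply,
    MultilinearMap.alternatization_apply, basisForm, map_sum]
  refine Fintype.sum_equiv finSumFinEquiv.permCongr _ _ fun σ => ?_
  simp [Fin.prod_univ_add, Equiv.permCongr_apply]

theorem e_eq_basisForm (i : Fin 6) : e i = basisForm ![i] := by
  ext v
  simp [e, basisForm_apply]

theorem add_wedge {k l : ℕ} (α α' : Form k) (β : Form l) :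
    (α + α') ⋏ β = α ⋏ β + α' ⋏ β := by
  ext v
  simp [wedge, ← AlternatingMap.domCoprod'_apply, TensorProduct.add_tmul,
    -AlternatingMap.domCoprod_apply]

theorem wedge_add {k l : ℕ} (α : Form k) (β β' : Form l) :
    α ⋏ (β + β') = α ⋏ β + α ⋏ β' := by
  ext v
  simp [wedge, ← AlternatingMap.domCoprod'_apply, TensorProduct.tmul_add,
    -AlternatingMap.domCoprod_apply]

theorem smul_wedge {k l : ℕ} (c : ℝ) (α : Form k) (β : Form l) :
    (c • α) ⋏ β = c • (α ⋏ β) := by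
  ext v
  simp [wedge, ← AlternatingMap.domCoprod'_apply, ← TensorProduct.smul_tmul',
    -AlternatingMap.domCoprod_apply]

theorem wedge_smul {k l : ℕ} (c : ℝ) (α : Form k) (β : Form l) :
    α ⋏ (c • β) = c • (α ⋏ β) := by
  ext v
  simp [wedge, ← AlternatingMap.domCoprod'_apply, -AlternatingMap.domCoprod_apply]

theorem basisForm_wedge_one_one (i j : Fin 6) :
    basisForm ![i] ⋏ basisForm ![j] = basisForm ![i, j] := by
  rw [basisForm_wedge]
  congr 1
  ext m; fin_cases m <;> rfl

theorem basisForm_wedge_two_one (i j k : Fin 6) :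
    basisForm ![i, j] ⋏ basisForm ![k] = basisForm ![i, j, k] := by
  rw [basisForm_wedge]
  congr 1
  ext m; fin_cases m <;> rfl

theorem omega_eq_basisForm :
    ω = basisForm ![0, 1] + basisForm ![2, 3] + basisForm ![4, 5] := by
  simp only [ω, e_eq_basisForm, basisForm_wedge_one_one]

/-- The Levi-Civita symbol of a multi-index: the product over `i < j` of the sign of
`I j - I i`. -/
def leviCivita (I : Fin 6 → Fin 6) : ℤ :=
  ∏ i, ∏ j ∈ Finset.Ioi i, if I i < I j then 1 else if I j < I i then -1 else 0

theorem leviCivita_perm (σ : Equiv.Perm (Fin 6)) : leviCivita σ = Equiv.Perm.sign σ := by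
  rw [Equiv.Perm.sign_eq_prod_prod_Ioi, leviCivita]
  push_cast
  refine Finset.prod_congr rfl fun i _ => Finset.prod_congr rfl fun j hj => ?_
  have hne : σ i ≠ σ j := fun h => (Finset.mem_Ioi.1 hj).ne (σ.injective h)
  rcases hne.lt_or_gt with h | h
  · simp [h]
  · simp [h, h.not_gt]

theorem leviCivita_eq_zero {I : Fin 6 → Fin 6} (hI : ¬ Function.Injective I) :
    leviCivita I = 0 := by
  rw [Function.not_injective_iff] at hI
  obtain ⟨i, j, hij, hne⟩ := hI
  wlog h : i < j generalizing i j
  · exact this j i hij.symm hne.symm (lt_of_le_of_ne (not_lt.1 h) hne.symm)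
  exact Finset.prod_eq_zero (Finset.mem_univ i)
    (Finset.prod_eq_zero (Finset.mem_Ioi.2 h) (by simp [hij]))

theorem basisForm_apply_b (I : Fin 6 → Fin 6) : basisForm I b = leviCivita I := by
  rw [basisForm_apply]
  by_cases hI : Function.Injective I
  · obtain ⟨σ, rfl⟩ : ∃ σ : Equiv.Perm (Fin 6), ⇑σ = I :=
      ⟨Equiv.ofBijective I (Finite.injective_iff_bijective.1 hI), rfl⟩
    rw [leviCivita_perm, ← Matrix.det_permutation, ← Matrix.det_transpose]
    congr 1
    ext i j
    simp [b, Pi.single_apply, PEquiv.toMatrix_apply, Equiv.toPEquiv_apply, eq_comm]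
  · rw [leviCivita_eq_zero hI]
    rw [Function.not_injective_iff] at hI
    obtain ⟨i, j, hij, hne⟩ := hI
    rw [Matrix.det_zero_of_column_eq hne fun k => by simp [hij], Int.cast_zero]

theorem sum_smul_wedge {k l : ℕ} {ι : Type*} [Fintype ι] (x : ι → ℝ) (α : ι → Form k)
    (β : Form l) : (∑ i, x i • α i) ⋏ β = ∑ i, x i • (α i ⋏ β) := by
  let f : Form k →ₗ[ℝ] Form (k + l) :=
    IsLinearMap.mk' (fun α => α ⋏ β) ⟨fun _ _ => add_wedge _ _ _, fun _ _ => smul_wedge _ _ _⟩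
  change f _ = ∑ i, x i • f (α i)
  simp only [map_sum, map_smul]

theorem wedge_sum_smul {k l : ℕ} {ι : Type*} [Fintype ι] (α : Form k) (x : ι → ℝ)
    (β : ι → Form l) : α ⋏ (∑ i, x i • β i) = ∑ i, x i • (α ⋏ β i) := by
  let f : Form l →ₗ[ℝ] Form (k + l) :=
    IsLinearMap.mk' (fun β => α ⋏ β) ⟨fun _ _ => wedge_add _ _ _, fun _ _ => wedge_smul _ _ _⟩
  change f _ = ∑ i, x i • f (β i)
  simp only [map_sum, map_smul]

theorem form_sum_apply {k : ℕ} {ι : Type*} [Fintype ι] (α : ι → Form k) (v : Fin k → V6) :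
    (∑ i, α i) v = ∑ i, α i v := by
  let f : Form k →ₗ[ℝ] ℝ := IsLinearMap.mk' (fun α => α v) ⟨fun _ _ => rfl, fun _ _ => rfl⟩
  exact map_sum f α Finset.univ

theorem sum_wedge_sum_wedge_sum_apply {k l m : ℕ} {ι κ μ : Type*}
    [Fintype ι] [Fintype κ] [Fintype μ] (x : ι → ℝ) (y : κ → ℝ) (I : ι → Fin k → Fin 6)
    (J : κ → Fin l → Fin 6) (K : μ → Fin m → Fin 6) (v : Fin (k + l + m) → V6) :
    ((∑ i, x i • basisForm (I i)) ⋏ (∑ j, y j • basisForm (J j)) ⋏ (∑ s, basisForm (K s))) v =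
      ∑ i, ∑ j, x i * y j *
        ∑ s, basisForm (Fin.append (Fin.append (I i) (J j)) (K s)) v := by
  have hK : ∑ s, basisForm (K s) = ∑ s, (1 : ℝ) • basisForm (K s) := by simp
  rw [hK, sum_smul_wedge, sum_smul_wedge]
  simp only [wedge_sum_smul (basisForm _), basisForm_wedge, sum_smul_wedge]
  simp [form_sum_apply, Finset.mul_sum, mul_assoc]

/-- The coefficient of `α ∧ β ∧ γ` with respect to the standard volume form. -/
def wedgeCoeff (α β γ : Form 2) : ℝ := (α ⋏ β ⋏ γ : Form 6) b

theorem wedgeCoeff_sum {ι κ μ : Type*} [Fintype ι] [Fintype κ] [Fintype μ]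
    (x : ι → ℝ) (y : κ → ℝ) (I : ι → Fin 2 → Fin 6) (J : κ → Fin 2 → Fin 6)
    (K : μ → Fin 2 → Fin 6) :
    wedgeCoeff (∑ i, x i • basisForm (I i)) (∑ j, y j • basisForm (J j)) (∑ s, basisForm (K s)) =
      ∑ i, ∑ j, x i * y j *
        ((∑ s, leviCivita (Fin.append (Fin.append (I i) (J j)) (K s)) : ℤ) : ℝ) := by
  rw [wedgeCoeff, sum_wedge_sum_wedge_sum_apply]
  push_cast
  simp only [← basisForm_apply_b]

/-- The multi-indices of the terms of the symplectic form. -/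
def omegaIndex : Fin 3 → Fin 2 → Fin 6 := ![![0, 1], ![2, 3], ![4, 5]]

theorem omega_eq_sum : ω = ∑ s, basisForm (omegaIndex s) := by
  simp [omega_eq_basisForm, Fin.sum_univ_three, omegaIndex]

/-- The multi-indices of the contractions of `e¹³⁵ + e²⁴⁶` with the standard basis vectors,
ordered so that every coefficient is one. -/
def contractionIndex : Fin 6 → Fin 2 → Fin 6 :=
  ![![2, 4], ![3, 5], ![4, 0], ![5, 1], ![0, 2], ![1, 3]]

theorem iota_eq_sum (v : V6) :
    iota v (basisForm ![0, 2, 4] + basisForm ![1, 3, 5]) =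
      ∑ t, v t • basisForm (contractionIndex t) := by
  ext w
  simp [iota, basisForm_apply, Matrix.det_fin_three, Matrix.det_fin_two, contractionIndex,
    Fin.sum_univ_six]
  ring

theorem volω_apply_b : volω b = 1 := by
  have h : wedgeCoeff ω ω ω = 6 := by
    have hω : ω = ∑ s, (1 : ℝ) • basisForm (omegaIndex s) := by simp [omega_eq_sum]
    nth_rw 1 2 [hω]
    rw [omega_eq_sum, wedgeCoeff_sum]
    simp only [one_mul]
    exact_mod_cast (by decide +kernel : (∑ i, ∑ j, ∑ k, leviCivita
      (Fin.append (Fin.append (omegaIndex i) (omegaIndex j)) (omegaIndex k))) = 6)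
  change (6 : ℝ)⁻¹ * wedgeCoeff ω ω ω = 1
  rw [h]
  norm_num

theorem wedgeCoeff_iota_iota_omega (v w : V6) :
    wedgeCoeff (iota v (basisForm ![0, 2, 4] + basisForm ![1, 3, 5]))
      (iota w (basisForm ![0, 2, 4] + basisForm ![1, 3, 5])) ω =
      -(v 0 * w 1 + v 1 * w 0 + v 2 * w 3 + v 3 * w 2 + v 4 * w 5 + v 5 * w 4) := by
  have key : ∀ i j, (∑ k, leviCivita (Fin.append
      (Fin.append (contractionIndex i) (contractionIndex j)) (omegaIndex k))) =
      if j = ![1, 0, 3, 2, 5, 4] i then -1 else 0 := by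
    decide +kernel
  rw [iota_eq_sum, iota_eq_sum, omega_eq_sum, wedgeCoeff_sum]
  simp only [key]
  simp [Fin.sum_univ_six]

/-- The embedding `(x, y, z) ↦ (x, c x, y, c y, z, c z)` of `ℝ³` in `ℝ⁶`. -/
def diagonalEmbedding (c : ℝ) : (Fin 3 → ℝ) →ₗ[ℝ] V6 where
  toFun x := ![x 0, c * x 0, x 1, c * x 1, x 2, c * x 2]
  map_add' x y := by
    ext i; fin_cases i <;> simp [mul_add]
  map_smul' r x := by
    ext i; fin_cases i <;> simp [mul_left_comm]

theorem diagonalEmbedding_apply (c : ℝ) (x : Fin 3 → ℝ) :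
    diagonalEmbedding c x = ![x 0, c * x 0, x 1, c * x 1, x 2, c * x 2] :=
  rfl

theorem finrank_range_diagonalEmbedding (c : ℝ) :
    Module.finrank ℝ (LinearMap.range (diagonalEmbedding c)) = 3 := by
  rw [LinearMap.finrank_range_of_inj, Module.finrank_fin_fun]
  intro x y h
  ext i
  fin_cases i
  · exact congrFun h 0
  · exact congrFun h 2
  · exact congrFun h 4

theorem sum_sq_pos_of_diagonalEmbedding_ne_zero {c : ℝ} {x : Fin 3 → ℝ}
    (hx : diagonalEmbedding c x ≠ 0) : 0 < x 0 * x 0 + x 1 * x 1 + x 2 * x 2 := by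
  have hx0 : x ≠ 0 := fun h => hx (by rw [h, map_zero])
  obtain ⟨i, hi⟩ := Function.ne_iff.1 hx0
  have hs : 0 < ∑ i, x i * x i :=
    Finset.sum_pos' (fun i _ => mul_self_nonneg _) ⟨i, Finset.mem_univ i, mul_self_pos.2 hi⟩
  rwa [Fin.sum_univ_three] at hs

/-- For ω = e¹² + e³⁴ + e⁵⁶ and φ = e¹³⁵ + e²⁴⁶, the bilinear form q with
q(v₁,v₂)·(ω³/3!) = ι_{v₁}φ ∧ ι_{v₂}φ ∧ ω is non-degenerate of split signature:
there are 3-dimensional subspaces on which it is positive (resp. negative) definite. -/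
theorem q_split_signature_Oplus (φ : Form 3) (B : V6 →ₗ[ℝ] V6 →ₗ[ℝ] ℝ)
    (hφ : φ = e 0 ⋏ e 2 ⋏ e 4 + e 1 ⋏ e 3 ⋏ e 5)
    (hB : ∀ v₁ v₂ : V6, (iota v₁ φ ⋏ iota v₂ φ ⋏ ω : Form 6) = B v₁ v₂ • volω) :
    LinearMap.ker B = ⊥ ∧
    ∃ P N : Submodule ℝ V6, Module.finrank ℝ P = 3 ∧ Module.finrank ℝ N = 3 ∧
      (∀ v ∈ P, v ≠ 0 → 0 < B v v) ∧ (∀ v ∈ N, v ≠ 0 → B v v < 0) := by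
  have hq (v w : V6) : B v w =
      -(v 0 * w 1 + v 1 * w 0 + v 2 * w 3 + v 3 * w 2 + v 4 * w 5 + v 5 * w 4) := by
    have h := congrArg (fun δ : Form 6 => δ b) (hB v w)
    simp only [hφ, e_eq_basisForm, basisForm_wedge_one_one, basisForm_wedge_two_one] at h
    change wedgeCoeff _ _ ω = B v w * volω b at h
    rw [wedgeCoeff_iota_iota_omega, volω_apply_b, mul_one] at h
    exact h.symm
  refine ⟨?_, ?_⟩
  · rw [LinearMap.ker_eq_bot']
    intro v hv
    have h (i : Fin 6) : B v (b i) = 0 := by rw [hv, LinearMap.zero_apply]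
    ext i
    fin_cases i
    · simpa [hq, b] using h 1
    · simpa [hq, b] using h 0
    · simpa [hq, b] using h 3
    · simpa [hq, b] using h 2
    · simpa [hq, b] using h 5
    · simpa [hq, b] using h 4
  · refine ⟨LinearMap.range (diagonalEmbedding (-1)), LinearMap.range (diagonalEmbedding 1),
      finrank_range_diagonalEmbedding _, finrank_range_diagonalEmbedding _, ?_, ?_⟩
    · rintro _ ⟨x, rfl⟩ hx
      have := sum_sq_pos_of_diagonalEmbedding_ne_zero hx
      simp only [hq, diagonalEmbedding_apply, Matrix.cons_val]
      linarith
    · rintro _ ⟨x, rfl⟩ hx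
      have := sum_sq_pos_of_diagonalEmbedding_ne_zero hx
      simp only [hq, diagonalEmbedding_apply, Matrix.cons_val]
      linarith
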